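/- Let C be a symmetric positive definite p×p matrix and λ_{0,1},…,λ_{0,p} ∈ [0,1]. For ζ ∈ [−∞,∞]^p define V^ζ(u) = u'Cu + 2 Σ_{j=1}^p λ_{0,j} [ 1{ζ_j ∈ ℝ}(|u_j + ζ_j| − |ζ_j|) + 1{|ζ_j| = ∞} sgn(ζ_j) u_j ] for u ∈ ℝ^p, and let 𝓜 = ⋃_{ζ ∈ [−∞,∞]^p} argmin_{u ∈ ℝ^p} V^ζ(u). Then 𝓜 = {m ∈ ℝ^p : |(Cm)_j| ≤ λ_{0,j} for all j = 1,…,p}, which equals the image under C^{−1} of the box {z ∈ ℝ^p : |z_j| ≤ λ_{0,j} for all j = 1,…,p}. -/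

import Mathlib

open MeasureTheory ProbabilityTheory Filter Matrix Set
open scoped ENNReal NNReal BigOperators

noncomputable section

/-- The penalty term `1{ζ_j ∈ ℝ}(|u_j + ζ_j| − |ζ_j|) + 1{|ζ_j| = ∞} sgn(ζ_j) u_j`,
multiplied by the tuning weight `λ_j`. -/
def penTerm (ζj : EReal) (lamj uj : ℝ) : ℝ :=
  if ζj = ⊤ then lamj * uj
  else if ζj = ⊥ then -(lamj * uj)
  else lamj * (|uj + ζj.toReal| - |ζj.toReal|)

/-- The function `V^ζ(u) = u'Cu + 2 Σ_j λ_{0,j}[1{ζ_j ∈ ℝ}(|u_j + ζ_j| − |ζ_j|) +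
1{|ζ_j| = ∞} sgn(ζ_j) u_j]`. -/
def Vfun {p : ℕ} (C : Matrix (Fin p) (Fin p) ℝ) (lam0 : Fin p → ℝ)
    (ζ : Fin p → EReal) (u : Fin p → ℝ) : ℝ :=
  u ⬝ᵥ C.mulVec u + 2 * ∑ j, penTerm (ζ j) (lam0 j) (u j)

/-- The penalty term is Lipschitz in its last argument, with the tuning weight as constant. -/
lemma penTerm_add_le (ζj : EReal) {l : ℝ} (hl : 0 ≤ l) (a t : ℝ) :
    penTerm ζj l (a + t) ≤ penTerm ζj l a + l * |t| := by
  have h₁ : l * t ≤ l * |t| := mul_le_mul_of_nonneg_left (le_abs_self t) hl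
  have h₂ : l * (-t) ≤ l * |t| := mul_le_mul_of_nonneg_left (neg_le_abs t) hl
  unfold penTerm
  split_ifs
  · linarith
  · linarith
  · have h : |a + t + ζj.toReal| ≤ |a + ζj.toReal| + |t| := by
      rw [add_right_comm]
      exact abs_add_le _ _
    linarith [mul_le_mul_of_nonneg_left h hl]

lemma penTerm_coe (x l a : ℝ) : penTerm (x : EReal) l a = l * (|a + x| - |x|) := by
  simp [penTerm]

/-- Expansion of the quadratic form of a symmetric matrix around a point. -/
lemma dotProduct_mulVec_add {ι : Type*} [Fintype ι] {C : Matrix ι ι ℝ} (hC : Cᵀ = C)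
    (m d : ι → ℝ) :
    (m + d) ⬝ᵥ C.mulVec (m + d) =
      m ⬝ᵥ C.mulVec m + 2 * (d ⬝ᵥ C.mulVec m) + d ⬝ᵥ C.mulVec d := by
  have h : m ⬝ᵥ C.mulVec d = d ⬝ᵥ C.mulVec m := by
    rw [dotProduct_mulVec, ← mulVec_transpose, hC, dotProduct_comm]
  rw [mulVec_add, add_dotProduct, dotProduct_add, dotProduct_add, h]
  ring

/-- A minimizer `m` of `V^ζ` satisfies `|(Cm)_j| ≤ λ_j`. -/
lemma abs_mulVec_le_of_forall_Vfun_le {p : ℕ} {C : Matrix (Fin p) (Fin p) ℝ} (hC : C.PosDef)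
    {lam0 : Fin p → ℝ} (hlam0 : ∀ j, 0 ≤ lam0 j) {ζ : Fin p → EReal} {m : Fin p → ℝ}
    (hm : ∀ u, Vfun C lam0 ζ m ≤ Vfun C lam0 ζ u) (j : Fin p) :
    |C.mulVec m j| ≤ lam0 j := by
  have hsymm : Cᵀ = C := by simpa using hC.isHermitian.eq
  have hc : 0 < C j j := hC.diag_pos
  have key (t : ℝ) : 0 ≤ 2 * t * C.mulVec m j + t ^ 2 * C j j + 2 * (lam0 j * |t|) := by
    have h := hm (m + Pi.single j t)
    have hpen : ∑ i, penTerm (ζ i) (lam0 i) ((m + Pi.single j t : Fin p → ℝ) i) ≤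
        ∑ i, penTerm (ζ i) (lam0 i) (m i) + lam0 j * |t| := by
      calc _ ≤ ∑ i, (penTerm (ζ i) (lam0 i) (m i) +
            lam0 i * |(Pi.single j t : Fin p → ℝ) i|) :=
            Finset.sum_le_sum fun i _ => penTerm_add_le _ (hlam0 i) _ _
        _ = _ := by
            rw [Finset.sum_add_distrib, Finset.sum_eq_single (ι := Fin p)
              (f := fun i => lam0 i * |(Pi.single j t : Fin p → ℝ) i|) j
              (by simp +contextual) (by simp), Pi.single_eq_same]
    unfold Vfun at h
    have hquad : (Pi.single j t : Fin p → ℝ) ⬝ᵥ C.mulVec (Pi.single j t) = t ^ 2 * C j j := by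
      rw [single_dotProduct, mulVec_single]
      simp
      ring
    rw [dotProduct_mulVec_add hsymm, hquad, single_dotProduct] at h
    linarith
  by_contra! hlt
  set s := (|C.mulVec m j| - lam0 j) / C j j with hs
  have hs0 : 0 < s := div_pos (sub_pos.2 hlt) hc
  have hsc : s * C j j = |C.mulVec m j| - lam0 j := div_mul_cancel₀ _ hc.ne'
  have hpos : 0 < s * (s * C j j) := mul_pos hs0 (mul_pos hs0 hc)
  have hfin : s * |C.mulVec m j| = s * (s * C j j) + s * lam0 j := by rw [hsc]; ring
  rcases abs_cases (C.mulVec m j) with ⟨h, -⟩ | ⟨h, -⟩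
  · have hk := key (-s)
    rw [abs_neg, abs_of_pos hs0] at hk
    rw [h] at hfin
    nlinarith
  · have hk := key s
    rw [abs_of_pos hs0] at hk
    rw [h] at hfin
    nlinarith

/-- If `|(Cm)_j| ≤ λ_j` for all `j`, then `m` minimizes `V^ζ` with `ζ = -m`. -/
lemma Vfun_neg_le {p : ℕ} {C : Matrix (Fin p) (Fin p) ℝ} (hC : C.PosDef)
    {lam0 m : Fin p → ℝ} (hm : ∀ j, |C.mulVec m j| ≤ lam0 j) (u : Fin p → ℝ) :
    Vfun C lam0 (fun j => ((-m j : ℝ) : EReal)) m ≤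
      Vfun C lam0 (fun j => ((-m j : ℝ) : EReal)) u := by
  have hsymm : Cᵀ = C := by simpa using hC.isHermitian.eq
  obtain ⟨d, rfl⟩ : ∃ d, u = m + d := ⟨u - m, by simp⟩
  have hd : 0 ≤ d ⬝ᵥ C.mulVec d := by simpa using hC.posSemidef.dotProduct_mulVec_nonneg d
  have hsum : 0 ≤ ∑ j, (d j * C.mulVec m j + (penTerm ((-m j : ℝ) : EReal) (lam0 j) ((m + d) j) -
      penTerm ((-m j : ℝ) : EReal) (lam0 j) (m j))) := by
    refine Finset.sum_nonneg fun j _ => ?_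
    have h₁ := neg_abs_le (d j * C.mulVec m j)
    rw [abs_mul] at h₁
    have h₂ := mul_le_mul_of_nonneg_left (hm j) (abs_nonneg (d j))
    have h₃ : m j + d j + -m j = d j := by ring
    rw [penTerm_coe, penTerm_coe, Pi.add_apply, h₃, add_neg_cancel, abs_zero]
    linarith
  rw [Finset.sum_add_distrib, Finset.sum_sub_distrib] at hsum
  unfold Vfun
  rw [dotProduct_mulVec_add hsymm]
  have hdot : d ⬝ᵥ C.mulVec m = ∑ j, d j * C.mulVec m j := rfl
  linarith

/-- The set `𝓜 = ⋃_{ζ ∈ [−∞,∞]^p} argmin_u V^ζ(u)` equals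
`{m : |(Cm)_j| ≤ λ_{0,j} ∀j}`, which equals `C⁻¹ {z : |z_j| ≤ λ_{0,j} ∀j}`. -/
theorem scriptM_eq {p : ℕ} (C : Matrix (Fin p) (Fin p) ℝ) (hC : C.PosDef)
    (lam0 : Fin p → ℝ) (hlam0 : ∀ j, lam0 j ∈ Set.Icc (0 : ℝ) 1) :
    (⋃ ζ : Fin p → EReal, {m : Fin p → ℝ | ∀ u, Vfun C lam0 ζ m ≤ Vfun C lam0 ζ u}) =
      {m : Fin p → ℝ | ∀ j, |C.mulVec m j| ≤ lam0 j} ∧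
    {m : Fin p → ℝ | ∀ j, |C.mulVec m j| ≤ lam0 j} =
      C⁻¹.mulVec '' {z : Fin p → ℝ | ∀ j, |z j| ≤ lam0 j} := by
  have hdet : IsUnit C.det := (Matrix.isUnit_iff_isUnit_det C).1 hC.isUnit
  refine ⟨?_, ?_⟩
  · ext m
    simp only [mem_iUnion, mem_ofPred_eq]
    exact ⟨fun ⟨_, hm⟩ => abs_mulVec_le_of_forall_Vfun_le hC (fun j => (hlam0 j).1) hm,
      fun hm => ⟨_, Vfun_neg_le hC hm⟩⟩
  · ext m
    constructor
    · intro hm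
      exact ⟨C.mulVec m, hm, by rw [mulVec_mulVec, nonsing_inv_mul C hdet, one_mulVec]⟩
    · rintro ⟨z, hz, rfl⟩
      simpa [mulVec_mulVec, mul_nonsing_inv C hdet] using hz
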